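/- Let ẼF(n) = |E(F̃_n)| be the number of edges of the tilde-Fibonacci cube of order n, and let N = f_{n+2} be its number of vertices. Then there exists n_0 such that for all n ≥ n_0, 0.85 < ẼF(n) / (N·(3·log₂ N − 1)/4) < 0.86, where N·(3·log₂ N − 1)/4 is the edge-count formula of the tilde-hypercube evaluated at N vertices (with log₂ the real base-2 logarithm). -/

import Mathlib

/-- One tilde edit step: a replacement (flip one symbol) or a swap of two
adjacent distinct symbols. -/
inductive TStep : List Bool → List Bool → Prop
  | repl (x y : List Bool) (a : Bool) : TStep (x ++ a :: y) (x ++ (!a) :: y)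
  | swap (x y : List Bool) (a : Bool) : TStep (x ++ a :: (!a) :: y) (x ++ (!a) :: a :: y)

/-- `reach step h u v` : `v` can be obtained from `u` by a chain of `h` steps. -/
def reach (step : List Bool → List Bool → Prop) : ℕ → List Bool → List Bool → Prop
  | 0 => Eq
  | h + 1 => fun u v => ∃ w, step u w ∧ reach step h w v

/-- The tilde-distance: the minimum number of replacements and swaps needed to
transform `u` into `v`. -/
noncomputable def tildeDist (u v : List Bool) : ℕ := sInf {h | reach TStep h u v}

theorem TStep.symm {u v : List Bool} (h : TStep u v) : TStep v u := by
  cases h with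
  | repl x y a => simpa using TStep.repl x y (!a)
  | swap x y a => simpa using TStep.swap x y (!a)

theorem reach_snoc {step : List Bool → List Bool → Prop} :
    ∀ {h : ℕ} {u v w : List Bool}, reach step h u v → step v w → reach step (h + 1) u w := by
  intro h
  induction h with
  | zero => intro u v w r s; exact ⟨w, r ▸ s, rfl⟩
  | succ h ih => intro u v w r s; obtain ⟨z, su, rz⟩ := r; exact ⟨z, su, ih rz s⟩

theorem reach_symm : ∀ {h : ℕ} {u v : List Bool}, reach TStep h u v → reach TStep h v u := by
  intro h
  induction h with
  | zero => intro u v r; exact r.symm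
  | succ h ih => intro u v r; obtain ⟨w, s, rw⟩ := r; exact reach_snoc (ih rw) s.symm

theorem tildeDist_comm (u v : List Bool) : tildeDist u v = tildeDist v u := by
  unfold tildeDist
  congr 1
  ext h
  exact ⟨fun r => reach_symm r, fun r => reach_symm r⟩

theorem tildeDist_self (u : List Bool) : tildeDist u u = 0 :=
  Nat.sInf_eq_zero.mpr (Or.inl rfl)

/-- The Hamming distance: the number of positions at which `u` and `v` differ. -/
def hammDist (u v : List Bool) : ℕ := ((u.zip v).filter fun p => p.1 != p.2).length

theorem hammDist_comm : ∀ u v : List Bool, hammDist u v = hammDist v u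
  | [], [] => rfl
  | [], _ :: _ => rfl
  | _ :: _, [] => rfl
  | a :: u, b :: v => by
    cases a <;> cases b <;>
      simp [hammDist, List.filter_cons, hammDist_comm u v, hammDist] <;>
      simpa [hammDist] using hammDist_comm u v

theorem hammDist_self : ∀ u : List Bool, hammDist u u = 0
  | [] => rfl
  | a :: u => by simpa [hammDist, List.filter_cons] using hammDist_self u

/-- Binary words of length `n`. -/
abbrev Word (n : ℕ) := {w : List Bool // w.length = n}

/-- The `n`-tilde-hypercube: vertices are the binary words of length `n`, and
two vertices are adjacent iff their tilde-distance is `1`. -/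
noncomputable def tildeCube (n : ℕ) : SimpleGraph (Word n) where
  Adj u v := tildeDist u.val v.val = 1
  symm := ⟨by intro u v h; rwa [tildeDist_comm]⟩
  loopless := ⟨by intro u h; rw [tildeDist_self] at h; exact one_ne_zero h.symm⟩

/-- The `n`-hypercube: vertices are the binary words of length `n`, and
two vertices are adjacent iff their Hamming distance is `1`. -/
def hamCube (n : ℕ) : SimpleGraph (Word n) where
  Adj u v := hammDist u.val v.val = 1
  symm := ⟨by intro u v h; rwa [hammDist_comm]⟩
  loopless := ⟨by intro u h; rw [hammDist_self] at h; exact one_ne_zero h.symm⟩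

/-- `f` is tilde-isometric. -/
def TildeIsometric (f : List Bool) : Prop :=
  ∀ n : ℕ, f.length ≤ n → ∀ u v : List Bool, u.length = n → v.length = n →
    ¬ f <:+: u → ¬ f <:+: v →
    ∃ w : ℕ → List Bool, w 0 = u ∧ w (tildeDist u v) = v ∧
      (∀ k < tildeDist u v, tildeDist (w k) (w (k + 1)) = 1) ∧
      (∀ k ≤ tildeDist u v, ¬ f <:+: w k)

/-- `f` is Ham-isometric. -/
def HamIsometric (f : List Bool) : Prop :=
  ∀ u v : List Bool, u.length = v.length →
    ¬ f <:+: u → ¬ f <:+: v →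
    ∃ w : ℕ → List Bool, w 0 = u ∧ w (hammDist u v) = v ∧
      (∀ k ≤ hammDist u v, (w k).length = u.length) ∧
      (∀ k < hammDist u v, hammDist (w k) (w (k + 1)) = 1) ∧
      (∀ k ≤ hammDist u v, ¬ f <:+: w k)
/-- The set of words of length `n` avoiding the factor `11`. -/
def fibFree (n : ℕ) : Set (Word n) := {w | ¬ [true, true] <:+: w.val}

/-- The `n`-tilde-Fibonacci cube: the subgraph of the tilde-hypercube induced by
the words avoiding the factor `11`. -/
noncomputable def tildeFibCube (n : ℕ) : SimpleGraph (fibFree n) :=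
  (tildeCube n).induce (fibFree n)

/-- The `n`-Fibonacci cube: the subgraph of the hypercube induced by
the words avoiding the factor `11`. -/
def fibCube (n : ℕ) : SimpleGraph (fibFree n) :=
  (hamCube n).induce (fibFree n)


inductive DStep : List Bool → List Bool → Prop
  | flip (y : List Bool) : DStep (false :: y) (true :: y)
  | swap (y : List Bool) : DStep (false :: true :: y) (true :: false :: y)
  | cons (a : Bool) {u v : List Bool} (h : DStep u v) : DStep (a :: u) (a :: v)

theorem DStep.irrefl' {u v : List Bool} (h : DStep u v) : u ≠ v := by
  induction h with
  | flip y => simp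
  | swap y => simp
  | cons a h ih => simpa using ih

theorem DStep.asymm' {u v : List Bool} (h : DStep u v) : ¬ DStep v u := by
  induction h with
  | flip y => intro h; cases h
  | swap y => intro h; cases h
  | cons a h ih =>
    intro h'
    cases h' with
    | cons _ h' => exact ih h'

theorem DStep.append (x : List Bool) {u v : List Bool} (h : DStep u v) :
    DStep (x ++ u) (x ++ v) := by
  induction x with
  | nil => exact h
  | cons a x ih => exact DStep.cons a ih

theorem DStep.toT {u v : List Bool} (h : DStep u v) : TStep u v := by
  induction h with
  | flip y => exact TStep.repl [] y false
  | swap y => exact TStep.swap [] y false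
  | cons a h ih =>
    cases ih with
    | repl x y b => exact TStep.repl (a :: x) y b
    | swap x y b => exact TStep.swap (a :: x) y b

theorem tstep_iff {u v : List Bool} : TStep u v ↔ DStep u v ∨ DStep v u := by
  constructor
  · intro h
    cases h with
    | repl x y a =>
      cases a
      · exact Or.inl ((DStep.flip y).append x)
      · exact Or.inr ((DStep.flip y).append x)
    | swap x y a =>
      cases a
      · exact Or.inl ((DStep.swap y).append x)
      · exact Or.inr ((DStep.swap y).append x)
  · rintro (h | h)
    · exact h.toT
    · exact h.toT.symm

theorem reach_one {u v : List Bool} : reach TStep 1 u v ↔ TStep u v := by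
  simp [reach]

theorem tildeDist_one {u v : List Bool} : tildeDist u v = 1 ↔ TStep u v := by
  unfold tildeDist
  constructor
  · intro h
    have hne : {h | reach TStep h u v}.Nonempty := by
      by_contra hc
      rw [Set.not_nonempty_iff_eq_empty] at hc
      rw [hc] at h
      simp at h
    have := Nat.sInf_mem hne
    rw [h] at this
    exact reach_one.1 this
  · intro h
    have h1 : (1 : ℕ) ∈ {h | reach TStep h u v} := reach_one.2 h
    have h2 := Nat.sInf_le h1
    have h3 : sInf {h | reach TStep h u v} ≠ 0 := by
      intro h0
      rcases Nat.sInf_eq_zero.1 h0 with h4 | h4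
      · have h5 : u = v := h4
        rcases tstep_iff.1 h with h6 | h6
        · exact h6.irrefl' h5
        · exact h6.irrefl' h5.symm
      · rw [h4] at h1; exact h1
    omega

def Fr (u : List Bool) : Prop := ¬ [true, true] <:+: u

theorem fr_nil : Fr [] := by simp [Fr]
theorem fr_f (u : List Bool) : Fr (false :: u) ↔ Fr u := by
  simp [Fr, List.infix_cons_iff]
theorem fr_t1 : Fr [true] := by simp [Fr, List.infix_cons_iff]
theorem fr_tt (u : List Bool) : ¬ Fr (true :: true :: u) := by
  simp [Fr, List.infix_cons_iff]
theorem fr_tf (u : List Bool) : Fr (true :: false :: u) ↔ Fr u := by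
  simp [Fr, List.infix_cons_iff]

def FF : ℕ → Finset (List Bool)
  | 0 => {[]}
  | 1 => {[false], [true]}
  | n + 2 => (FF (n + 1)).image (fun u => false :: u) ∪ (FF n).image (fun u => true :: false :: u)

theorem mem_FF (n : ℕ) : ∀ u, u ∈ FF n ↔ u.length = n ∧ Fr u := by
  induction n using Nat.twoStepInduction with
  | zero => intro u; cases u <;> simp [FF, fr_nil]
  | one =>
    intro u
    rcases u with _ | ⟨_ | _, _ | ⟨b, u⟩⟩ <;> simp [FF, fr_nil, fr_f, fr_t1]
  | more n ih1 ih2 =>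
    intro u
    rcases u with _ | ⟨_ | _, _ | ⟨_ | _, u⟩⟩ <;>
      simp [FF, ih1, ih2, fr_f, fr_tf, fr_tt]

theorem card_FF (n : ℕ) : (FF n).card = Nat.fib (n + 2) := by
  induction n using Nat.twoStepInduction with
  | zero => rfl
  | one => rfl
  | more n ih1 ih2 =>
    rw [FF, Finset.card_union_of_disjoint, Finset.card_image_of_injective,
      Finset.card_image_of_injective, ih1, ih2, Nat.fib_add_two (n := n + 2)]
    · ring
    · intro a b h; simpa using h
    · intro a b h; simpa using h
    · rw [Finset.disjoint_left]; intro a; simp only [Finset.mem_image]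
      rintro ⟨b, _, rfl⟩ ⟨c, _, h⟩; simp at h

def GG : ℕ → Finset (List Bool)
  | 0 => {[]}
  | n + 1 => (FF n).image (fun u => false :: u)

theorem mem_GG (n : ℕ) (u : List Bool) : u ∈ GG n ↔ u.length = n ∧ Fr (true :: u) := by
  rcases n with _ | n
  · cases u <;> simp [GG, fr_t1]
  · rcases u with _ | ⟨_ | _, u⟩ <;> simp [GG, mem_FF, fr_tf, fr_tt]

theorem card_GG (n : ℕ) : (GG n).card = Nat.fib (n + 1) := by
  rcases n with _ | n
  · rfl
  · rw [GG, Finset.card_image_of_injective, card_FF]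
    intro a b h; simpa using h

def ES : ℕ → Finset (List Bool × List Bool)
  | 0 => ∅
  | 1 => {([false], [true])}
  | n + 2 => ((ES (n + 1)).image (fun p => (false :: p.1, false :: p.2)) ∪
      (ES n).image (fun p => (true :: false :: p.1, true :: false :: p.2))) ∪
      ((FF n).image (fun u => (false :: false :: u, true :: false :: u)) ∪
      (GG n).image (fun u => (false :: true :: u, true :: false :: u)))

theorem dstep_ff {a : Bool} {u v : List Bool} : DStep (a :: u) (a :: v) ↔ DStep u v := by
  constructor
  · intro h; cases h; assumption
  · exact DStep.cons a

theorem dstep_tf {u v : List Bool} : ¬ DStep (true :: u) (false :: v) := by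
  intro h; cases h

theorem dstep_ft {u v : List Bool} : DStep (false :: u) (true :: v) ↔
    u = v ∨ ∃ y, u = true :: y ∧ v = false :: y := by
  constructor
  · intro h
    cases h with
    | flip => exact Or.inl rfl
    | swap y => exact Or.inr ⟨y, rfl, rfl⟩
  · rintro (rfl | ⟨y, rfl, rfl⟩)
    · exact DStep.flip _
    · exact DStep.swap _

theorem dstep_nil_left {v : List Bool} : ¬ DStep [] v := by intro h; cases h
theorem dstep_nil_right {v : List Bool} : ¬ DStep v [] := by intro h; cases h

theorem fr_t_imp {u : List Bool} (h : Fr (true :: u)) : Fr u := by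
  rcases u with _ | ⟨_ | _, u⟩
  · exact fr_nil
  · rw [fr_f]; exact (fr_tf _).1 h
  · exact absurd h (fr_tt _)

theorem mem_ES (n : ℕ) : ∀ u v, (u, v) ∈ ES n ↔
    u.length = n ∧ v.length = n ∧ Fr u ∧ Fr v ∧ DStep u v := by
  induction n using Nat.twoStepInduction with
  | zero =>
    intro u v
    rcases u with _ | ⟨a, u⟩ <;> simp [ES, dstep_nil_left]
  | one =>
    intro u v
    rcases u with _ | ⟨_ | _, _ | ⟨b, u⟩⟩ <;> rcases v with _ | ⟨_ | _, _ | ⟨c, v⟩⟩ <;>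
      simp [ES, dstep_ff, dstep_tf, dstep_ft, dstep_nil_left, fr_nil, fr_f, fr_t1]
  | more n ih1 ih2 =>
    intro u v
    rcases u with _ | ⟨_ | _, _ | ⟨_ | _, u⟩⟩ <;> rcases v with _ | ⟨_ | _, _ | ⟨_ | _, v⟩⟩ <;>
      simp [ES, ih1, ih2, mem_FF, mem_GG, fr_f, fr_tf, fr_tt, dstep_ff, dstep_tf, dstep_ft,
        dstep_nil_left, dstep_nil_right]
    · grind
    · constructor
      · rintro ⟨h1, rfl⟩; exact ⟨h1.1, h1.1, h1.2, fr_t_imp h1.2, rfl⟩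
      · rintro ⟨h1, _, h2, _, rfl⟩; exact ⟨⟨h1, h2⟩, rfl⟩

theorem card_ES_rec (n : ℕ) :
    (ES (n + 2)).card = (ES (n + 1)).card + (ES n).card + Nat.fib (n + 3) := by
  rw [ES, Finset.card_union_of_disjoint, Finset.card_union_of_disjoint,
    Finset.card_union_of_disjoint, Finset.card_image_of_injective,
    Finset.card_image_of_injective, Finset.card_image_of_injective,
    Finset.card_image_of_injective, card_FF, card_GG, Nat.fib_add_two (n := n + 1)]
  · ring
  · intro a b h; simpa using h
  · intro a b h; simpa using h
  · rintro ⟨a, b⟩ ⟨c, d⟩ h; simpa using h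
  · rintro ⟨a, b⟩ ⟨c, d⟩ h; simpa using h
  · rw [Finset.disjoint_left]; intro a; simp only [Finset.mem_image]
    rintro ⟨b, _, rfl⟩ ⟨c, _, h⟩; simp at h
  · rw [Finset.disjoint_left]; intro a; simp only [Finset.mem_image]
    rintro ⟨b, _, rfl⟩ ⟨c, _, h⟩; simp at h
  · rw [Finset.disjoint_left]; intro a; simp only [Finset.mem_image, Finset.mem_union]
    rintro (⟨b, _, rfl⟩ | ⟨b, _, rfl⟩) (⟨c, _, h⟩ | ⟨c, _, h⟩) <;> simp at h

theorem card_ES (n : ℕ) :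
    5 * (ES n).card = n * (2 * Nat.fib (n + 1) + Nat.fib (n + 2)) + Nat.fib n := by
  induction n using Nat.twoStepInduction with
  | zero => rfl
  | one => rfl
  | more n ih1 ih2 =>
    rw [card_ES_rec]
    have e1 : Nat.fib (n + 2) = Nat.fib n + Nat.fib (n + 1) := Nat.fib_add_two
    have e2 : Nat.fib (n + 3) = Nat.fib (n + 1) + Nat.fib (n + 2) := Nat.fib_add_two
    have e3 : Nat.fib (n + 4) = Nat.fib (n + 2) + Nat.fib (n + 3) := Nat.fib_add_two
    simp only [show n + 1 + 1 = n + 2 from rfl, show n + 1 + 2 = n + 3 from rfl,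
      show n + 2 + 1 = n + 3 from rfl, show n + 2 + 2 = n + 4 from rfl] at *
    rw [mul_add, mul_add, ih1, ih2, e3, e2, e1]
    ring

theorem card_edges (n : ℕ) : Nat.card (tildeFibCube n).edgeSet = (ES n).card := by
  have hadj : ∀ a b : fibFree n, (tildeFibCube n).Adj a b ↔ TStep a.1.1 b.1.1 :=
    fun a b => tildeDist_one
  rw [← Nat.card_eq_finsetCard (ES n)]
  symm
  have hm : ∀ p : ES n, p.1.1.length = n ∧ p.1.2.length = n ∧ Fr p.1.1 ∧ Fr p.1.2 ∧
      DStep p.1.1 p.1.2 := fun p => (mem_ES n _ _).1 p.2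
  let A : ES n → fibFree n := fun p => ⟨⟨p.1.1, (hm p).1⟩, (hm p).2.2.1⟩
  let B : ES n → fibFree n := fun p => ⟨⟨p.1.2, (hm p).2.1⟩, (hm p).2.2.2.1⟩
  have hAB : ∀ p, s(A p, B p) ∈ (tildeFibCube n).edgeSet := fun p =>
    (SimpleGraph.mem_edgeSet _).2 ((hadj _ _).2 (hm p).2.2.2.2.toT)
  refine Nat.card_eq_of_bijective (fun p => ⟨s(A p, B p), hAB p⟩) ⟨?_, ?_⟩
  · intro p q h
    have h' : s(A p, B p) = s(A q, B q) := congrArg Subtype.val h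
    rcases Sym2.eq_iff.1 h' with ⟨h1, h2⟩ | ⟨h1, h2⟩
    · have h3 : p.1.1 = q.1.1 := congrArg (fun x : fibFree n => x.1.1) h1
      have h4 : p.1.2 = q.1.2 := congrArg (fun x : fibFree n => x.1.1) h2
      exact Subtype.ext (Prod.ext h3 h4)
    · have h3 : p.1.1 = q.1.2 := congrArg (fun x : fibFree n => x.1.1) h1
      have h4 : p.1.2 = q.1.1 := congrArg (fun x : fibFree n => x.1.1) h2
      have h5 := (hm p).2.2.2.2
      rw [h3, h4] at h5
      exact absurd h5 (hm q).2.2.2.2.asymm'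
  · rintro ⟨e, he⟩
    induction e using Sym2.ind with
    | _ a b =>
      have h := (hadj a b).1 ((SimpleGraph.mem_edgeSet _).1 he)
      rcases tstep_iff.1 h with h | h
      · exact ⟨⟨(a.1.1, b.1.1), (mem_ES n _ _).2 ⟨a.1.2, b.1.2, a.2, b.2, h⟩⟩, rfl⟩
      · exact ⟨⟨(b.1.1, a.1.1), (mem_ES n _ _).2 ⟨b.1.2, a.1.2, b.2, a.2, h⟩⟩,
          Subtype.ext Sym2.eq_swap⟩

theorem phi_pow_le (n : ℕ) : Real.goldenRatio ^ n ≤ (Nat.fib (n + 2) : ℝ) ∧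
    (Nat.fib (n + 2) : ℝ) ≤ Real.goldenRatio ^ (n + 1) := by
  have h2 := Real.goldenRatio_sq
  induction n using Nat.twoStepInduction with
  | zero => simp [Nat.fib]; exact Real.one_lt_goldenRatio.le
  | one => 
    have := Real.one_lt_goldenRatio
    have := Real.goldenRatio_lt_two
    norm_num [Nat.fib]; constructor <;> nlinarith
  | more n ih1 ih2 =>
    rw [Nat.fib_add_two (n := n + 2)]
    push_cast
    have e1 : Real.goldenRatio ^ (n + 2) = Real.goldenRatio ^ n + Real.goldenRatio ^ (n + 1) := by
      rw [pow_add, h2]; ring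
    have e2 : Real.goldenRatio ^ (n + 2 + 1)
        = Real.goldenRatio ^ (n + 1) + Real.goldenRatio ^ (n + 1 + 1) := by
      rw [show n + 2 + 1 = n + 1 + 2 by ring, pow_add, h2]; ring
    rw [e1, e2]
    constructor
    · linarith [ih1.1, ih2.1]
    · linarith [ih1.2, ih2.2]

theorem ratio_bd (n : ℕ) :
    (0.618 : ℝ) * Nat.fib (n + 30 + 2) ≤ Nat.fib (n + 30 + 1) ∧
    (Nat.fib (n + 30 + 1) : ℝ) ≤ 0.6181 * Nat.fib (n + 30 + 2) := by
  induction n with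
  | zero => norm_num [Nat.fib_add_two]
  | succ n ih =>
    rw [show n + 1 + 30 + 2 = n + 30 + 1 + 2 by ring, show n + 1 + 30 + 1 = n + 30 + 2 by ring,
      Nat.fib_add_two (n := n + 30 + 1)]
    push_cast
    have : (0 : ℝ) ≤ Nat.fib (n + 30 + 2) := by positivity
    simp only [show n + 30 + 1 + 1 = n + 30 + 2 from rfl]
    constructor <;> linarith [ih.1, ih.2]

theorem phi_bounds : (1.618033 : ℝ) < Real.goldenRatio ∧ Real.goldenRatio < 1.618034 := by
  have h2 := Real.goldenRatio_sq
  have := Real.one_lt_goldenRatio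
  constructor <;> nlinarith

theorem log_phi : (34 / 49 : ℝ) ≤ Real.logb 2 Real.goldenRatio ∧
    Real.logb 2 Real.goldenRatio ≤ 7 / 10 := by
  obtain ⟨h1, h2⟩ := phi_bounds
  have hp := Real.goldenRatio_pos
  constructor
  · have : (2 : ℝ) ^ 34 ≤ Real.goldenRatio ^ 49 :=
      le_trans (by norm_num) (pow_le_pow_left₀ (by norm_num) h1.le 49)
    have := Real.logb_le_logb_of_le (b := 2) (by norm_num) (by norm_num) this
    rw [Real.logb_pow, Real.logb_pow, Real.logb_self_eq_one (by norm_num)] at this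
    push_cast at this
    linarith
  · have : Real.goldenRatio ^ 10 ≤ (2 : ℝ) ^ 7 :=
      le_trans (pow_le_pow_left₀ hp.le h2.le 10) (by norm_num)
    have := Real.logb_le_logb_of_le (b := 2) (by norm_num) (by positivity) this
    rw [Real.logb_pow, Real.logb_pow, Real.logb_self_eq_one (by norm_num)] at this
    push_cast at this
    linarith

theorem log_fib (n : ℕ) : (34 / 49 : ℝ) * n ≤ Real.logb 2 (Nat.fib (n + 2)) ∧
    Real.logb 2 (Nat.fib (n + 2)) ≤ 7 / 10 * (n + 1) := by
  obtain ⟨h1, h2⟩ := phi_pow_le n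
  obtain ⟨h3, h4⟩ := log_phi
  have hp := Real.goldenRatio_pos
  have hf : (0 : ℝ) < Nat.fib (n + 2) := by exact_mod_cast Nat.fib_pos.2 (by omega)
  have a1 := Real.logb_le_logb_of_le (b := 2) (by norm_num) (by positivity) h1
  have a2 := Real.logb_le_logb_of_le (b := 2) (by norm_num) hf h2
  rw [Real.logb_pow] at a1 a2
  push_cast at a2
  have : (0 : ℝ) ≤ n := by positivity
  constructor <;> nlinarith

/-- Asymptotically, the ratio between the number of edges of the tilde-Fibonacci
cube and the edge-count formula of the tilde-hypercube evaluated at the same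
number of vertices `N = f_{n+2}` lies strictly between `0.85` and `0.86`. -/
theorem tildeFibCube_edge_ratio :
    ∃ n₀ : ℕ, ∀ n : ℕ, n₀ ≤ n →
      0.85 < (Nat.card (tildeFibCube n).edgeSet : ℝ) /
          ((Nat.fib (n + 2) : ℝ) * (3 * Real.logb 2 (Nat.fib (n + 2)) - 1) / 4) ∧
      (Nat.card (tildeFibCube n).edgeSet : ℝ) /
          ((Nat.fib (n + 2) : ℝ) * (3 * Real.logb 2 (Nat.fib (n + 2)) - 1) / 4) < 0.86 := by
  refine ⟨10000, fun n hn => ?_⟩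
  rw [card_edges]
  have hE : (5 : ℝ) * (ES n).card
      = n * (2 * Nat.fib (n + 1) + Nat.fib (n + 2)) + Nat.fib n := by
    exact_mod_cast card_ES n
  have hr := ratio_bd (n - 30)
  rw [show n - 30 + 30 = n by omega] at hr
  obtain ⟨l1, l2⟩ := log_fib n
  have hf : (0 : ℝ) < Nat.fib (n + 2) := by exact_mod_cast Nat.fib_pos.2 (by omega)
  have hfn : (Nat.fib n : ℝ) ≤ Nat.fib (n + 2) := by
    exact_mod_cast Nat.fib_mono (by omega)
  have hfn0 : (0 : ℝ) ≤ Nat.fib n := by positivity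
  have hn' : (10000 : ℝ) ≤ n := by exact_mod_cast hn
  set N : ℝ := (Nat.fib (n + 2) : ℝ)
  set l := Real.logb 2 N
  have hlo : (n : ℝ) * (2.236 * N) ≤ 5 * (ES n).card := by
    rw [hE]
    have : (n : ℝ) * (2.236 * N) ≤ n * (2 * Nat.fib (n + 1) + N) :=
      mul_le_mul_of_nonneg_left (by linarith [hr.1]) (by linarith)
    linarith
  have hhi : 5 * ((ES n).card : ℝ) ≤ n * (2.2362 * N) + N := by
    rw [hE]
    have : (n : ℝ) * (2 * Nat.fib (n + 1) + N) ≤ n * (2.2362 * N) :=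
      mul_le_mul_of_nonneg_left (by linarith [hr.2]) (by linarith)
    linarith
  have hD : 0 < N * (3 * l - 1) / 4 := by
    have : 0 < 3 * l - 1 := by linarith
    positivity
  constructor
  · rw [lt_div_iff₀ hD]
    have : N * (0.85 * (3 * l - 1) / 4 * 5) < N * (n * 2.236) :=
      mul_lt_mul_of_pos_left (by linarith) hf
    linarith
  · rw [div_lt_iff₀ hD]
    have : N * (n * 2.2362 + 1) < N * (0.86 * (3 * l - 1) / 4 * 5) :=
      mul_lt_mul_of_pos_left (by linarith) hf
    linarith
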